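/- A completely metrizable space X is 2^ω-partitionable if and only if it is 2^ω-coverable, if and only if X has no isolated points. -/

import Mathlib

open Cardinal Set TopologicalSpace

/-- The Cantor space `2^ω`. -/
abbrev CantorSpace : Type := ℕ → Bool

/-- `X` is `Y`-coverable: there is a family of subspaces of `X`, each homeomorphic to `Y`,
whose union is `X`. -/
def Coverable (X Y : Type*) [TopologicalSpace X] [TopologicalSpace Y] : Prop :=
  ∃ C : Set (Set X), (∀ K ∈ C, Nonempty (K ≃ₜ Y)) ∧ ⋃₀ C = Set.univ

/-- `X` is `Y`-partitionable: there is a partition of `X` into pairwise disjoint subspaces,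
each homeomorphic to `Y`. -/
def Partitionable (X Y : Type*) [TopologicalSpace X] [TopologicalSpace Y] : Prop :=
  ∃ P : Set (Set X), (∀ K ∈ P, Nonempty (K ≃ₜ Y)) ∧ P.PairwiseDisjoint id ∧ ⋃₀ P = Set.univ

/-- A packing of copies of `Y` into `X`: a pairwise disjoint family of subspaces of `X`,
each homeomorphic to `Y`. -/
def IsPacking {X : Type*} [TopologicalSpace X] (Y : Type*) [TopologicalSpace Y]
    (Q : Set (Set X)) : Prop :=
  (∀ K ∈ Q, Nonempty (K ≃ₜ Y)) ∧ Q.PairwiseDisjoint id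
/-- A topological space is completely metrizable if its topology is induced by some
complete metric. -/
def CompletelyMetrizable (X : Type*) [t : TopologicalSpace X] : Prop :=
  ∃ m : MetricSpace X, m.toUniformSpace.toTopologicalSpace = t ∧
    @CompleteSpace X m.toUniformSpace

/-- A subset of a topological space that is homeomorphic to the Cantor space. -/
def IsCantorSet {X : Type*} [TopologicalSpace X] (K : Set X) : Prop :=
  Nonempty (K ≃ₜ CantorSpace)

/-- A subset of a topological space that is the union of a disjoint family of Cantor sets. -/
def HasCantorPartition {X : Type*} [TopologicalSpace X] (S : Set X) : Prop :=
  ∃ P : Set (Set X), (∀ K ∈ P, IsCantorSet K) ∧ P.PairwiseDisjoint id ∧ ⋃₀ P = S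

section CantorSets

variable {X Y : Type*} [TopologicalSpace X] [TopologicalSpace Y]

theorem isCantorSet_range [T2Space X] {f : CantorSpace → X} (hf : Continuous f)
    (hinj : Function.Injective f) : IsCantorSet (range f) :=
  ⟨(hf.isClosedEmbedding hinj).isEmbedding.toHomeomorph.symm⟩

theorem IsCantorSet.exists_param {K : Set X} (hK : IsCantorSet K) :
    ∃ f : CantorSpace → X, Continuous f ∧ Function.Injective f ∧ range f = K := by
  obtain ⟨e⟩ := hK
  refine ⟨fun z => (e.symm z : X), by fun_prop,
    Subtype.val_injective.comp e.symm.injective, ?_⟩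
  have : range (Subtype.val ∘ e.symm) = K := by
    rw [e.symm.surjective.range_comp, Subtype.range_val]
  exact this

theorem IsCantorSet.image [T2Space Y] {K : Set X} (hK : IsCantorSet K) {g : X → Y}
    (hg : Continuous g) (hinj : Function.Injective g) : IsCantorSet (g '' K) := by
  obtain ⟨f, hf, hfi, rfl⟩ := hK.exists_param
  rw [← range_comp]
  exact isCantorSet_range (hg.comp hf) (hinj.comp hfi)

theorem IsCantorSet.nonempty {K : Set X} (hK : IsCantorSet K) : K.Nonempty := by
  obtain ⟨f, -, -, rfl⟩ := hK.exists_param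
  exact range_nonempty f

theorem IsCantorSet.hasCantorPartition {K : Set X} (hK : IsCantorSet K) :
    HasCantorPartition K :=
  ⟨{K}, by simpa using hK, by simp, by simp⟩

theorem HasCantorPartition.iUnion {ι : Type*} {S : ι → Set X}
    (hS : ∀ i, HasCantorPartition (S i)) (hd : Pairwise fun i j => Disjoint (S i) (S j)) :
    HasCantorPartition (⋃ i, S i) := by
  choose P hP hPd hPS using hS
  refine ⟨⋃ i, P i, ?_, ?_, ?_⟩
  · simp only [mem_iUnion]
    rintro K ⟨i, hi⟩
    exact hP i K hi
  · intro K hK L hL hne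
    obtain ⟨i, hi⟩ := mem_iUnion.1 hK
    obtain ⟨j, hj⟩ := mem_iUnion.1 hL
    by_cases hij : i = j
    · subst hij
      exact hPd i hi hj hne
    · refine (hd hij).mono ?_ ?_
      · exact (hPS i) ▸ subset_sUnion_of_mem hi
      · exact (hPS j) ▸ subset_sUnion_of_mem hj
  · rw [sUnion_iUnion]
    exact iUnion_congr hPS

theorem HasCantorPartition.union {S T : Set X} (hS : HasCantorPartition S)
    (hT : HasCantorPartition T) (hd : Disjoint S T) : HasCantorPartition (S ∪ T) := by
  rw [union_eq_iUnion]
  refine HasCantorPartition.iUnion (by rintro (_ | _) <;> assumption) ?_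
  rintro (_ | _) (_ | _) h <;> first | exact absurd rfl h | exact hd | exact hd.symm

theorem HasCantorPartition.image [T2Space Y] {S : Set X} (hS : HasCantorPartition S) {g : X → Y}
    (hg : Continuous g) (hinj : Function.Injective g) : HasCantorPartition (g '' S) := by
  obtain ⟨P, hP, hd, rfl⟩ := hS
  refine ⟨(g '' ·) '' P, ?_, ?_, ?_⟩
  · rintro _ ⟨K, hK, rfl⟩
    exact (hP K hK).image hg hinj
  · rintro _ ⟨K, hK, rfl⟩ _ ⟨L, hL, rfl⟩ hne
    have : K ≠ L := fun h => hne (by rw [h])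
    exact (disjoint_image_iff hinj).2 (hd hK hL this)
  · rw [sUnion_eq_biUnion, sUnion_eq_biUnion, image_iUnion₂, biUnion_image]

theorem Partitionable.coverable (h : Partitionable X Y) : Coverable X Y := by
  obtain ⟨P, hP, -, hU⟩ := h
  exact ⟨P, hP, hU⟩

/-- The point `z` with its first `n` coordinates replaced by those of `b`. -/
def cantorGlue (b : CantorSpace) (n : ℕ) (z : CantorSpace) : CantorSpace :=
  fun k => if k < n then b k else z (k - n)

theorem continuous_cantorGlue (b : CantorSpace) (n : ℕ) : Continuous (cantorGlue b n) := by
  refine continuous_pi fun k => ?_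
  unfold cantorGlue
  split_ifs <;> fun_prop

theorem injective_cantorGlue (b : CantorSpace) (n : ℕ) :
    Function.Injective (cantorGlue b n) := by
  intro y z h
  funext k
  simpa [cantorGlue] using congrFun h (k + n)

theorem range_cantorGlue (b : CantorSpace) (n : ℕ) :
    range (cantorGlue b n) = {z | ∀ k < n, z k = b k} := by
  ext z
  constructor
  · rintro ⟨y, rfl⟩ k hk
    simp [cantorGlue, hk]
  · intro hz
    refine ⟨fun k => z (k + n), funext fun k => ?_⟩
    unfold cantorGlue
    split_ifs with h
    · exact (hz k h).symm
    · simp [Nat.sub_add_cancel (not_lt.1 h)]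

theorem hasCantorPartition_compl_range_cantorGlue (b : CantorSpace) (n : ℕ) :
    HasCantorPartition (range (cantorGlue b n))ᶜ := by
  have key : (range (cantorGlue b n))ᶜ =
      ⋃ k : Fin n, range (cantorGlue (Function.update b k (!b k)) (k + 1)) := by
    ext z
    simp only [range_cantorGlue, mem_compl_iff, mem_ofPred_eq, mem_iUnion]
    constructor
    · intro h
      push Not at h
      have hex : ∃ k, k < n ∧ z k ≠ b k := by simpa using h
      classical
      let k := Nat.find hex
      have hk := Nat.find_spec hex
      refine ⟨⟨k, hk.1⟩, fun j hj => ?_⟩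
      rcases Nat.lt_succ_iff_lt_or_eq.1 hj with hj | hj
      · have hj' : j < k := hj
        rw [Function.update_of_ne (by simpa using hj'.ne)]
        have := Nat.find_min hex hj'
        by_contra hne
        exact this ⟨hj'.trans hk.1, hne⟩
      · have hj' : j = k := hj
        subst hj'
        simpa using Bool.eq_not.2 hk.2
    · rintro ⟨k, hk⟩ h
      have h1 := hk k (by simp)
      have h2 := h k k.2
      simp [h2] at h1
  rw [key]
  refine HasCantorPartition.iUnion
    (fun k => (isCantorSet_range (continuous_cantorGlue _ _)
      (injective_cantorGlue _ _)).hasCantorPartition) ?_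
  have aux : ∀ i j : Fin n, i < j →
      Disjoint (range (cantorGlue (Function.update b i (!b i)) (i + 1)))
        (range (cantorGlue (Function.update b j (!b j)) (j + 1))) := by
    intro i j hij
    rw [Set.disjoint_left]
    intro z hi hj
    rw [range_cantorGlue] at hi hj
    have h1 := hi i (by simp)
    have h2 := hj i (by have : (i : ℕ) < j := hij; omega)
    rw [Function.update_of_ne (by simpa [Fin.ext_iff] using hij.ne)] at h2
    simp [h2] at h1
  intro i j hij
  rcases lt_or_gt_of_ne hij with h | h
  · exact aux i j h
  · exact (aux j i h).symm

theorem exists_range_cantorGlue_subset {V : Set CantorSpace} (hV : IsOpen V) {b : CantorSpace}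
    (hb : b ∈ V) : ∃ n, range (cantorGlue b n) ⊆ V := by
  obtain ⟨I, u, hu, hs⟩ := isOpen_pi_iff.1 hV b hb
  obtain ⟨n, hn⟩ := I.exists_nat_subset_range
  refine ⟨n, fun z hz => hs fun k hk => ?_⟩
  rw [range_cantorGlue] at hz
  rw [hz k (Finset.mem_range.1 (hn hk))]
  exact (hu k hk).2

theorem continuum_le_mk_of_isOpen_cantorSpace {V : Set CantorSpace} (hV : IsOpen V)
    (hne : V.Nonempty) : 𝔠 ≤ #V := by
  obtain ⟨b, hb⟩ := hne
  obtain ⟨n, hn⟩ := exists_range_cantorGlue_subset hV hb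
  calc 𝔠 = #CantorSpace := by simp
    _ = #(range (cantorGlue b n)) := (mk_range_eq _ (injective_cantorGlue b n)).symm
    _ ≤ #V := mk_le_mk_of_subset hn

theorem Coverable.not_isOpen_singleton (h : Coverable X CantorSpace) (x : X) :
    ¬ IsOpen ({x} : Set X) := by
  intro hx
  obtain ⟨C, hC, hU⟩ := h
  obtain ⟨K, hK, hxK⟩ := mem_sUnion.1 (hU ▸ mem_univ x)
  obtain ⟨f, hf, hfi, rfl⟩ := IsCantorSet.exists_param (hC K hK)
  obtain ⟨b, rfl⟩ := hxK
  have h1 := continuum_le_mk_of_isOpen_cantorSpace (hx.preimage hf) ⟨b, rfl⟩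
  have h2 : f ⁻¹' {f b} = {b} := by
    ext y
    simp [hfi.eq_iff]
  rw [h2, mk_singleton] at h1
  exact absurd (one_lt_aleph0.trans aleph0_lt_continuum) h1.not_gt

end CantorSets

section Cellular

universe u

variable {Y : Type u} [MetricSpace Y]

/-- The set `O` contains a pairwise disjoint family of nonempty open sets indexed by `J`. -/
def HasCellularFamily {Y : Type*} [TopologicalSpace Y] (O : Set Y) (J : Type*) : Prop :=
  ∃ B : J → Set Y, (∀ j, IsOpen (B j) ∧ (B j).Nonempty ∧ B j ⊆ O) ∧
    Pairwise fun i j => Disjoint (B i) (B j)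

theorem HasCellularFamily.of_embedding {O : Set Y} {I J : Type*} (h : HasCellularFamily O J)
    (e : I ↪ J) : HasCellularFamily O I := by
  obtain ⟨B, hB, hd⟩ := h
  exact ⟨B ∘ e, fun i => hB _, fun i j hij => hd (e.injective.ne hij)⟩

theorem HasCellularFamily.sigma {O : Set Y} {I : Type*} {J : I → Type*} {B : I → Set Y}
    (hBO : ∀ i, B i ⊆ O) (hd : Pairwise fun i j => Disjoint (B i) (B j))
    (h : ∀ i, HasCellularFamily (B i) (J i)) : HasCellularFamily O (Σ i, J i) := by
  choose C hC hCd using h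
  refine ⟨fun p => C p.1 p.2, fun p => ⟨(hC _ _).1, (hC _ _).2.1, (hC _ _).2.2.trans (hBO _)⟩, ?_⟩
  rintro ⟨i, a⟩ ⟨j, b⟩ hne
  by_cases hij : i = j
  · subst hij
    exact hCd i fun hab => hne (congrArg (Sigma.mk i) hab)
  · exact (hd hij).mono (hC _ _).2.2 (hC _ _).2.2

theorem exists_maximal_separated (O : Set Y) {ε : ℝ} :
    ∃ D ⊆ O, (D.Pairwise fun x y => ε ≤ dist x y) ∧ ∀ x ∈ O, x ∉ D → ∃ d ∈ D, dist x d < ε := by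
  obtain ⟨D, hD⟩ := zorn_subset {D : Set Y | D ⊆ O ∧ D.Pairwise fun x y => ε ≤ dist x y} (by
    intro c hc hchain
    refine ⟨⋃₀ c, ⟨sUnion_subset fun s hs => (hc hs).1, ?_⟩, fun s hs => subset_sUnion_of_mem hs⟩
    exact (pairwise_sUnion hchain.directedOn).2 fun s hs => (hc hs).2)
  refine ⟨D, hD.prop.1, hD.prop.2, fun x hx hxD => ?_⟩
  by_contra! hcon
  have hins : insert x D ∈ {D : Set Y | D ⊆ O ∧ D.Pairwise fun x y => ε ≤ dist x y} := by
    refine ⟨insert_subset hx hD.prop.1, hD.prop.2.insert fun b hb _ => ⟨hcon b hb, ?_⟩⟩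
    rw [dist_comm]
    exact hcon b hb
  exact hxD (hD.le_of_ge hins (subset_insert x D) (mem_insert x D))

theorem hasCellularFamily_of_separated {O D : Set Y} (hO : IsOpen O) (hDO : D ⊆ O) {ε : ℝ}
    (hε : 0 < ε) (hD : D.Pairwise fun x y => ε ≤ dist x y) : HasCellularFamily O D := by
  refine ⟨fun d => Metric.ball d (ε / 2) ∩ O, fun d => ⟨Metric.isOpen_ball.inter hO,
    ⟨d, Metric.mem_ball_self (half_pos hε), hDO d.2⟩, inter_subset_right⟩, fun a b hab => ?_⟩
  refine (Metric.ball_disjoint_ball ?_).mono inter_subset_left inter_subset_left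
  have := hD a.2 b.2 (Subtype.coe_ne_coe.2 hab)
  linarith

theorem mk_le_power_of_subset_closure {O E : Set Y} (h : O ⊆ closure E) : #O ≤ #E ^ ℵ₀ := by
  choose s hs hlim using fun x : O => mem_closure_iff_seq_limit.1 (h x.2)
  have hinj : Function.Injective fun (x : O) (n : ℕ) => (⟨s x n, hs x n⟩ : E) := by
    intro x y hxy
    have : s x = s y := by
      funext n
      simpa using congrFun hxy n
    exact Subtype.ext (tendsto_nhds_unique (hlim x) (this ▸ hlim y))
  simpa using mk_le_of_injective hinj

/-- A metric space all of whose nonempty open sets have density at least `κ > ℵ₀` has cellular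
families of cardinality `κ` in all nonempty open sets. -/
theorem hasCellularFamily_of_density {κ : Cardinal.{u}} (hκ : ℵ₀ < κ)
    (hdens : ∀ O : Set Y, IsOpen O → O.Nonempty → ∀ E ⊆ O, O ⊆ closure E → κ ≤ #E)
    {O : Set Y} (hO : IsOpen O) (hne : O.Nonempty) {J : Type u} (hJ : #J ≤ κ) :
    HasCellularFamily O J := by
  have sep : ∀ O : Set Y, IsOpen O → O.Nonempty → ∃ D : ℕ → Set Y,
      (∀ n, HasCellularFamily O (D n)) ∧ κ ≤ #(Σ n, D n) := by
    intro O hO hne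
    choose D hDO hDs hDm using fun n : ℕ => exists_maximal_separated O (ε := 1 / ((n : ℝ) + 1))
    refine ⟨D, fun n => hasCellularFamily_of_separated hO (hDO n) (by positivity) (hDs n), ?_⟩
    have h1 : κ ≤ #(⋃ n, D n) := by
      refine hdens O hO hne _ (iUnion_subset hDO) fun x hx => ?_
      rw [Metric.mem_closure_iff]
      intro ε hε
      obtain ⟨n, hn⟩ := exists_nat_one_div_lt hε
      by_cases hxD : x ∈ D n
      · exact ⟨x, mem_iUnion.2 ⟨n, hxD⟩, by simpa using hε⟩
      · obtain ⟨d, hd, hxd⟩ := hDm n x hx hxD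
        exact ⟨d, mem_iUnion.2 ⟨n, hd⟩, hxd.trans hn⟩
    exact h1.trans (mk_le_of_surjective (sigmaToiUnion_surjective D))
  have small : ∀ O : Set Y, IsOpen O → O.Nonempty → ∀ J : Type u, #J < κ →
      HasCellularFamily O J := by
    intro O hO hne J hJ
    obtain ⟨D, hD, hDκ⟩ := sep O hO hne
    have : ∃ n, #J ≤ #(D n) := by
      by_contra! hcon
      have h2 : #(Σ n, D n) ≤ ℵ₀ * #J := by
        rw [mk_sigma]
        calc sum (fun n => #(D n)) ≤ sum (fun _ : ℕ => #J) := sum_le_sum _ _ fun n => (hcon n).le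
          _ = ℵ₀ * #J := by simp
      exact (hDκ.trans h2).not_gt (mul_lt_of_lt hκ.le hκ hJ)
    obtain ⟨n, ⟨e⟩⟩ := this
    exact (hD n).of_embedding e
  obtain ⟨D, hD, hDκ⟩ := sep O hO hne
  by_cases hbig : ∃ n, κ ≤ #(D n)
  · obtain ⟨n, hn⟩ := hbig
    obtain ⟨e⟩ := hJ.trans hn
    exact (hD n).of_embedding e
  · push Not at hbig
    obtain ⟨B, hB, hBd⟩ := small O hO hne (ULift ℕ) (by simpa using hκ)
    have hcell : HasCellularFamily O (Σ n, D n) :=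
      HasCellularFamily.sigma (B := fun n => B ⟨n⟩) (fun n => (hB _).2.2)
        (fun i j hij => hBd fun h => hij (by simpa using h))
        fun n => small _ (hB _).1 (hB _).2.1 _ (hbig n)
    obtain ⟨e⟩ := hJ.trans hDκ
    exact hcell.of_embedding e

theorem HasCellularFamily.exists_small {O : Set Y} {J : Type*} (h : HasCellularFamily O J)
    {ε : ℝ} (hε : 0 < ε) : ∃ B : J → Set Y, (∀ j, IsOpen (B j) ∧ (B j).Nonempty ∧
      closure (B j) ⊆ O ∧ Metric.ediam (B j) ≤ ENNReal.ofReal ε) ∧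
      Pairwise fun i j => Disjoint (B i) (B j) := by
  obtain ⟨C, hC, hd⟩ := h
  choose p hp using fun j => (hC j).2.1
  choose r hr hrC using fun j => Metric.nhds_basis_closedBall.mem_iff.1 ((hC j).1.mem_nhds (hp j))
  have hpos : ∀ j, 0 < min (r j) (ε / 2) := fun j => lt_min (hr j) (half_pos hε)
  have hsub : ∀ j, Metric.closedBall (p j) (min (r j) (ε / 2)) ⊆ C j := fun j =>
    (Metric.closedBall_subset_closedBall (min_le_left _ _)).trans (hrC j)
  refine ⟨fun j => Metric.ball (p j) (min (r j) (ε / 2)), fun j => ⟨Metric.isOpen_ball,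
    ⟨p j, Metric.mem_ball_self (hpos j)⟩,
    Metric.closure_ball_subset_closedBall.trans ((hsub j).trans (hC j).2.2), ?_⟩,
    fun i j hij => (hd hij).mono (Metric.ball_subset_closedBall.trans (hsub i))
      (Metric.ball_subset_closedBall.trans (hsub j))⟩
  refine Metric.ediam_le fun x hx y hy => ?_
  rw [edist_dist]
  refine ENNReal.ofReal_le_ofReal ?_
  have hx' := (Metric.mem_ball.1 hx).trans_le (min_le_right _ _)
  have hy' := (Metric.mem_ball.1 hy).trans_le (min_le_right _ _)
  have := dist_triangle_right x y (p j)
  linarith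

/-- If every nonempty open subset of a complete metric space contains a cellular family indexed
by `β`, then every nonempty open set contains an injective continuous image of `β^ω`. -/
theorem exists_continuous_injective_of_hasCellularFamily [CompleteSpace Y] {β : Type*}
    [TopologicalSpace β] [DiscreteTopology β]
    (h : ∀ O : Set Y, IsOpen O → O.Nonempty → HasCellularFamily O β)
    {O : Set Y} (hO : IsOpen O) (hne : O.Nonempty) :
    ∃ f : (ℕ → β) → Y, Continuous f ∧ Function.Injective f ∧ range f ⊆ O := by
  choose B hB hBd using fun (U : {U : Set Y // IsOpen U ∧ U.Nonempty}) (n : ℕ) =>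
    (h U.1 U.2.1 U.2.2).exists_small (ε := 1 / ((n : ℝ) + 1)) (by positivity)
  let A : List β → {U : Set Y // IsOpen U ∧ U.Nonempty} := fun l =>
    List.rec ⟨O, hO, hne⟩ (fun b l U => ⟨B U l.length b, (hB U l.length b).1,
      (hB U l.length b).2.1⟩) l
  have hcons : ∀ b l, (A (b :: l)).1 = B (A l) l.length b := fun b l => rfl
  let S : List β → Set Y := fun l => (A l).1
  have hanti : CantorScheme.ClosureAntitone S := fun l b => (hB (A l) l.length b).2.2.1
  have hdisj : CantorScheme.Disjoint S := fun l => hBd (A l) l.length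
  have hdiam : CantorScheme.VanishingDiam S := by
    intro x
    rw [← Filter.tendsto_add_atTop_iff_nat 1]
    have hlim : Filter.Tendsto (fun n : ℕ => ENNReal.ofReal (1 / ((n : ℝ) + 1))) Filter.atTop
        (nhds 0) := by
      have := ENNReal.tendsto_ofReal (tendsto_one_div_add_atTop_nhds_zero_nat (𝕜 := ℝ))
      simpa using this
    refine tendsto_of_tendsto_of_tendsto_of_le_of_le tendsto_const_nhds hlim
      (fun _ => bot_le) fun n => ?_
    have := (hB (A (PiNat.res x n)) (PiNat.res x n).length (x n)).2.2.2
    rw [PiNat.res_length] at this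
    simpa [S, PiNat.res_succ, hcons] using this
  have huniv := hanti.map_of_vanishingDiam hdiam fun l => (A l).2.2
  refine ⟨fun x => (CantorScheme.inducedMap S).2 ⟨x, huniv ▸ mem_univ x⟩,
    hdiam.map_continuous.comp (by fun_prop), fun x y hxy => ?_, ?_⟩
  · exact congrArg Subtype.val (hdisj.map_injective hxy)
  · rintro _ ⟨x, rfl⟩
    exact CantorScheme.map_mem (A := S) ⟨x, huniv ▸ mem_univ x⟩ 0

/-- If all nonempty open subsets of a complete metric space have more than `lam` points, then
every nonempty open set contains a Cantor set avoiding any given set of at most `lam` points. -/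
theorem exists_isCantorSet_disjoint [CompleteSpace Y] {lam : Cardinal.{u}} (hc : 𝔠 ≤ lam)
    (hlam : ∀ O : Set Y, IsOpen O → O.Nonempty → lam < #O) {A : Set Y} (hA : #A ≤ lam)
    {O : Set Y} (hO : IsOpen O) (hne : O.Nonempty) :
    ∃ K : Set Y, IsCantorSet K ∧ K ⊆ O ∧ Disjoint K A := by
  have hex : ∃ κ : Cardinal.{u}, lam < κ ^ ℵ₀ :=
    ⟨#O, (hlam O hO hne).trans_le (self_le_power _ one_le_aleph0)⟩
  obtain ⟨κ, hκ, hmin⟩ : ∃ κ : Cardinal.{u}, lam < κ ^ ℵ₀ ∧ ∀ ν, lam < ν ^ ℵ₀ → κ ≤ ν :=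
    ⟨sInf {κ | lam < κ ^ ℵ₀}, csInf_mem (s := {κ | lam < κ ^ ℵ₀}) hex, fun ν hν => csInf_le' hν⟩
  have hκ0 : ℵ₀ < κ := by
    by_contra! hcon
    have : κ ^ ℵ₀ ≤ 𝔠 := by
      rw [← aleph0_power_aleph0]
      exact power_le_power_right hcon
    exact (hκ.trans_le (this.trans hc)).false
  have hdens : ∀ O : Set Y, IsOpen O → O.Nonempty → ∀ E ⊆ O, O ⊆ closure E → κ ≤ #E :=
    fun O hO hne E _ hE => hmin _ ((hlam O hO hne).trans_le (mk_le_power_of_subset_closure hE))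
  let I := κ.out
  have hI : #(I × Bool) ≤ κ := by
    simp only [mk_prod, lift_uzero, I, mk_out, mk_bool]
    simpa using mul_le_of_le hκ0.le le_rfl (ofNat_lt_aleph0.le.trans hκ0.le)
  let _ : TopologicalSpace I := ⊥
  have _ : DiscreteTopology I := ⟨rfl⟩
  obtain ⟨f, hf, hfi, hfO⟩ := exists_continuous_injective_of_hasCellularFamily (β := I × Bool)
    (fun O hO hne => hasCellularFamily_of_density hκ0 hdens hO hne hI) hO hne
  let g : (ℕ → I) → CantorSpace → Y := fun a b => f fun n => (a n, b n)
  by_contra! hcon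
  have hmeet : ∀ a : ℕ → I, ∃ b, g a b ∈ A := by
    intro a
    have hg : Continuous (g a) := hf.comp (by fun_prop)
    have hgi : Function.Injective (g a) := by
      intro b b' hbb
      have := hfi hbb
      funext n
      exact congrArg Prod.snd (congrFun this n)
    have := hcon _ (isCantorSet_range hg hgi) (by
      rintro _ ⟨b, rfl⟩
      exact hfO (mem_range_self _))
    rw [Set.not_disjoint_iff] at this
    obtain ⟨_, ⟨b, rfl⟩, hb⟩ := this
    exact ⟨b, hb⟩
  choose b hb using hmeet
  have hle : #(ℕ → I) ≤ #A := mk_le_of_injective (f := fun a => (⟨g a (b a), hb a⟩ : A)) (by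
    intro a a' haa
    have := hfi (congrArg Subtype.val haa)
    funext n
    exact congrArg Prod.fst (congrFun this n))
  have : κ ^ ℵ₀ ≤ lam := by simpa [I] using hle.trans hA
  exact this.not_gt hκ

end Cellular

section MaximalPacking

universe u

variable {X : Type u}

theorem perfectSpace_of_not_isOpen_singleton [TopologicalSpace X]
    (h : ∀ x : X, ¬ IsOpen ({x} : Set X)) : PerfectSpace X := by
  rw [perfectSpace_iff_forall_not_isolated]
  intro x
  rw [Filter.neBot_iff, Ne, ← isOpen_singleton_iff_punctured_nhds]
  exact h x

theorem not_isOpen_singleton_of_perfectSpace [TopologicalSpace X] [PerfectSpace X] (x : X) :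
    ¬ IsOpen ({x} : Set X) := by
  rw [isOpen_singleton_iff_punctured_nhds, ← Ne, ← Filter.neBot_iff]
  exact perfectSpace_iff_forall_not_isolated.1 inferInstance x

theorem exists_isCantorSet_subset [MetricSpace X] [CompleteSpace X] [PerfectSpace X]
    {O : Set X} (hO : IsOpen O) (hne : O.Nonempty) : ∃ K ⊆ O, IsCantorSet K := by
  obtain ⟨x, hx⟩ := hne
  obtain ⟨r, hr, hrO⟩ := Metric.nhds_basis_closedBall.mem_iff.1 (hO.mem_nhds hx)
  have hperf : Perfect (closure (Metric.ball x r)) := Metric.isOpen_ball.perfect_closure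
  obtain ⟨f, hfr, hf, hfi⟩ := hperf.exists_nat_bool_injection
    ⟨x, subset_closure (Metric.mem_ball_self hr)⟩
  exact ⟨range f, hfr.trans (Metric.closure_ball_subset_closedBall.trans hrO),
    isCantorSet_range hf hfi⟩

/-- If `A` meets all Cantor sets of a perfect complete metric space, then it has as many points in
every open set as the whole space, up to the cardinality of the continuum. -/
theorem mk_le_max_mk_inter_continuum [MetricSpace X] [CompleteSpace X] [PerfectSpace X]
    {A : Set X} (hA : ∀ K, IsCantorSet K → (K ∩ A).Nonempty) {U : Set X} (hU : IsOpen U) :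
    #U ≤ max #(U ∩ A : Set X) 𝔠 := by
  by_contra! hlt
  set lam := max #(U ∩ A : Set X) 𝔠 with hlam
  have hc : 𝔠 ≤ lam := le_max_right _ _
  have h0 : ℵ₀ ≤ lam := aleph0_le_continuum.trans hc
  let Y : Set X := {x | ∀ W ∈ nhds x, lam < #(W ∩ U : Set X)}
  have hYclosed : IsClosed Y := by
    rw [← isOpen_compl_iff, isOpen_iff_mem_nhds]
    intro x hx
    simp only [Y, mem_compl_iff, mem_ofPred_eq, not_forall, not_lt] at hx
    obtain ⟨W, hW, hWle⟩ := hx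
    filter_upwards [eventually_mem_nhds_iff.2 hW] with y hy hyY
    exact (hyY W hy).not_ge hWle
  have hdense : ∀ x ∈ U, ∀ ε > 0, ∃ a ∈ U ∩ A, dist x a < ε := by
    intro x hx ε hε
    obtain ⟨K, hK, hKc⟩ := exists_isCantorSet_subset (Metric.isOpen_ball.inter hU)
      ⟨x, Metric.mem_ball_self hε, hx⟩
    obtain ⟨a, haK, haA⟩ := hA K hKc
    exact ⟨a, ⟨(hK haK).2, haA⟩, by rw [dist_comm]; exact (hK haK).1⟩
  have hdiff : #(U \ Y : Set X) ≤ lam := by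
    let I := {p : (U ∩ A : Set X) × ℕ //
      #(Metric.ball (p.1 : X) (1 / ((p.2 : ℝ) + 1)) ∩ U : Set X) ≤ lam}
    let F : I → Set X := fun p => Metric.ball (p.1.1 : X) (1 / ((p.1.2 : ℝ) + 1)) ∩ U
    have hsub : U \ Y ⊆ ⋃ p, F p := by
      rintro x ⟨hxU, hxY⟩
      simp only [Y, mem_ofPred_eq, not_forall, not_lt] at hxY
      obtain ⟨W, hW, hWle⟩ := hxY
      obtain ⟨ε, hε, hball⟩ := Metric.mem_nhds_iff.1 hW
      obtain ⟨n, hn⟩ := exists_nat_one_div_lt (half_pos hε)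
      obtain ⟨a, ha, hxa⟩ := hdense x hxU (1 / ((n : ℝ) + 1)) (by positivity)
      have hsub : Metric.ball a (1 / ((n : ℝ) + 1)) ⊆ W := by
        intro y hy
        apply hball
        have h1 := Metric.mem_ball.1 hy
        have h2 := dist_triangle_right y x a
        rw [Metric.mem_ball]
        linarith
      refine mem_iUnion.2 ⟨⟨(⟨a, ha⟩, n), ?_⟩, hxa, hxU⟩
      exact (mk_le_mk_of_subset (inter_subset_inter_left U hsub)).trans hWle
    have hI : #I ≤ lam := by
      refine (mk_subtype_le _).trans ?_
      simpa using mul_le_of_le h0 (le_max_left _ _) h0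
    calc #(U \ Y : Set X) ≤ #(⋃ p, F p) := mk_le_mk_of_subset hsub
      _ ≤ #I * ⨆ p, #(F p) := mk_iUnion_le _
      _ ≤ lam := mul_le_of_le h0 hI (ciSup_le' fun p => p.2)
  have hbig : ∀ W : Set X, lam < #(W ∩ U : Set X) → lam < #(W ∩ U ∩ Y : Set X) := by
    intro W hW
    by_contra! hcon
    have : #(W ∩ U : Set X) ≤ lam := by
      calc #(W ∩ U : Set X) ≤ #((W ∩ U ∩ Y) ∪ (U \ Y) : Set X) := by
            refine mk_le_mk_of_subset fun x hx => ?_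
            by_cases hxY : x ∈ Y
            · exact Or.inl ⟨hx, hxY⟩
            · exact Or.inr ⟨hx.2, hxY⟩
        _ ≤ _ := mk_union_le _ _
        _ ≤ lam := add_le_of_le h0 hcon hdiff
    exact this.not_gt hW
  have _ : CompleteSpace Y := hYclosed.completeSpace_coe
  have hYlam : ∀ O : Set Y, IsOpen O → O.Nonempty → lam < #O := by
    rintro _ hO ⟨y, hy⟩
    obtain ⟨W, hW, rfl⟩ := isOpen_induced_iff.1 hO
    refine (hbig W (y.2 W (hW.mem_nhds hy))).trans_le ?_
    refine mk_le_of_injective (f := fun x => ⟨⟨x.1, x.2.2⟩, x.2.1.1⟩) fun a b hab => ?_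
    simpa [Subtype.ext_iff] using hab
  have hUY : (Subtype.val ⁻¹' U : Set Y).Nonempty := by
    have := hbig univ (by simpa using hlt)
    have hpos : #(univ ∩ U ∩ Y : Set X) ≠ 0 := (bot_le.trans_lt this).ne'
    obtain ⟨⟨x, hx⟩⟩ := mk_ne_zero_iff.1 hpos
    exact ⟨⟨x, hx.2⟩, hx.1.2⟩
  obtain ⟨K, hK, hKU, hKA⟩ := exists_isCantorSet_disjoint hc hYlam
    (A := Subtype.val ⁻¹' (U ∩ A))
    ((mk_preimage_of_injective _ _ Subtype.val_injective).trans (le_max_left _ _))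
    (hU.preimage continuous_subtype_val) hUY
  obtain ⟨_, ⟨y, hy, rfl⟩, hyA⟩ :=
    hA _ (hK.image continuous_subtype_val Subtype.val_injective)
  exact Set.disjoint_left.1 hKA hy ⟨hKU hy, hyA⟩

/-- A family of Cantor sets extends to a disjoint family that meets all Cantor sets. -/
theorem exists_maximal_packing [TopologicalSpace X] {P : Set (Set X)}
    (hP : IsPacking CantorSpace P) :
    ∃ Q, P ⊆ Q ∧ IsPacking CantorSpace Q ∧ ∀ K, IsCantorSet K → (K ∩ ⋃₀ Q).Nonempty := by
  obtain ⟨Q, hPQ, hQ⟩ := zorn_subset_nonempty {Q : Set (Set X) | IsPacking CantorSpace Q} (by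
    intro c hc hchain _
    refine ⟨⋃₀ c, ⟨fun K hK => ?_, ?_⟩, fun s hs => subset_sUnion_of_mem hs⟩
    · obtain ⟨s, hs, hKs⟩ := hK
      exact (hc hs).1 K hKs
    · exact (pairwiseDisjoint_sUnion hchain.directedOn).2 fun s hs => (hc hs).2) P hP
  refine ⟨Q, hPQ, hQ.prop, fun K hK => ?_⟩
  by_contra hcon
  have hdisj : Disjoint K (⋃₀ Q) :=
    disjoint_iff_inter_eq_empty.2 (not_nonempty_iff_eq_empty.1 hcon)
  have hins : insert K Q ∈ {Q : Set (Set X) | IsPacking CantorSpace Q} := by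
    refine ⟨?_, hQ.prop.2.insert fun L hL _ => hdisj.mono_right (subset_sUnion_of_mem hL)⟩
    rintro L (rfl | hL)
    · exact hK
    · exact hQ.prop.1 L hL
  have hKQ : K ∈ Q := hQ.le_of_ge hins (subset_insert K Q) (mem_insert K Q)
  obtain ⟨x, hx⟩ := hK.nonempty
  exact hcon ⟨x, hx, K, hKQ, hx⟩

theorem exists_injective_choice {ι α : Type u} {S : ι → Set α} (hS : ∀ i, #ι ≤ #(S i)) :
    ∃ f : ι → α, Function.Injective f ∧ ∀ i, f i ∈ S i := by
  obtain ⟨r, hr, hord⟩ := exists_ord_eq ι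
  have hex : ∀ (i : ι) (g : ∀ j, r j i → α), ∃ a ∈ S i, ∀ j (h : r j i), g j h ≠ a := by
    intro i g
    by_contra! hcon
    have h1 : #(S i) ≤ #{j // r j i} := by
      refine (mk_le_mk_of_subset (t := range fun j : {j // r j i} => g j.1 j.2) ?_).trans
        mk_range_le
      intro a ha
      obtain ⟨j, hj, rfl⟩ := hcon a ha
      exact ⟨⟨j, hj⟩, rfl⟩
    have h2 : #{j // r j i} < #ι := card_typein_lt i hord
    exact ((hS i).trans h1).not_gt h2
  choose c hcS hc using hex
  let f : ι → α := hr.wf.fix c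
  have hf : ∀ i, f i = c i fun j _ => f j := hr.wf.fix_eq c
  have hne : ∀ i j, r j i → f j ≠ f i := by
    intro i j hji
    exact (hf i).symm ▸ hc i (fun j _ => f j) j hji
  refine ⟨f, fun i j hij => ?_, fun i => ?_⟩
  · rcases trichotomous_of r i j with h | h | h
    · exact absurd hij (hne j i h)
    · exact h
    · exact absurd hij.symm (hne i j h)
  · rw [hf i]
    exact hcS i _

end MaximalPacking

section Absorption

universe u

theorem eventually_forall_lt_eq (z : CantorSpace) (n : ℕ) :
    ∀ᶠ w in nhds z, ∀ k < n, w k = z k := by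
  have : ∀ᶠ w in nhds z, ∀ k ∈ Finset.range n, w k = z k := by
    rw [Filter.eventually_all_finset]
    intro k _
    exact (continuous_apply k).continuousAt.eventually
      ((isOpen_discrete {z k}).mem_nhds (mem_singleton _))
  simpa using this

/-- Disjoint Cantor sets that converge to a point form a Cantor set together with that point. -/
theorem isCantorSet_insert_iUnion {X : Type*} [MetricSpace X] {x : X} {g : ℕ → CantorSpace → X}
    (hg : ∀ n, Continuous (g n)) (hinj : ∀ n, Function.Injective (g n))
    (hd : Pairwise fun m n => Disjoint (range (g m)) (range (g n)))
    (hx : ∀ n, x ∉ range (g n))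
    (hb : ∀ n, range (g n) ⊆ Metric.ball x (1 / ((n : ℝ) + 1))) :
    IsCantorSet (insert x (⋃ n, range (g n))) := by
  classical
  let h : CantorSpace → X := fun z =>
    if hz : ∃ n, z n = false then g (Nat.find hz) (fun k => z (Nat.find hz + 1 + k)) else x
  have h_g : ∀ z n, (∀ k < n, z k = true) → z n = false →
      h z = g n (fun k => z (n + 1 + k)) := by
    intro z n hlt hn
    have hz : ∃ n, z n = false := ⟨n, hn⟩
    have hfind : Nat.find hz = n := by
      rw [Nat.find_eq_iff]
      exact ⟨hn, fun k hk => by simp [hlt k hk]⟩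
    simp only [h, dif_pos hz, hfind]
  have h_x : ∀ z, (∀ k, z k = true) → h z = x := by
    intro z hz
    have : ¬ ∃ n, z n = false := by simpa using hz
    simp only [h, dif_neg this]
  have hcases : ∀ z : CantorSpace,
      (∀ k, z k = true) ∨ ∃ n, (∀ k < n, z k = true) ∧ z n = false := by
    intro z
    by_cases hz : ∃ n, z n = false
    · exact Or.inr ⟨Nat.find hz, fun k hk => by simpa using Nat.find_min hz hk, Nat.find_spec hz⟩
    · exact Or.inl (by simpa using hz)
  have hcont : Continuous h := by
    rw [continuous_iff_continuousAt]
    intro z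
    rcases hcases z with hz | ⟨n, hlt, hn⟩
    · rw [Metric.continuousAt_iff']
      intro ε hε
      obtain ⟨N, hN⟩ := exists_nat_one_div_lt hε
      filter_upwards [eventually_forall_lt_eq z N] with w hw
      rw [h_x z hz]
      rcases hcases w with hw' | ⟨n, hlt, hn⟩
      · rwa [h_x w hw', dist_self]
      · have hNn : N ≤ n := by
          by_contra! hcon
          simp [hw n hcon, hz n] at hn
        rw [h_g w n hlt hn]
        refine (Metric.mem_ball.1 (hb n ⟨_, rfl⟩)).trans_le ?_
        refine le_trans ?_ hN.le
        exact Nat.one_div_le_one_div hNn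
    · have hev : (fun w => g n (fun k => w (n + 1 + k))) =ᶠ[nhds z] h := by
        filter_upwards [eventually_forall_lt_eq z (n + 1)] with w hw
        refine (h_g w n (fun k hk => ?_) ?_).symm
        · rw [hw k (by omega), hlt k hk]
        · rw [hw n (by omega), hn]
      refine ContinuousAt.congr ?_ hev
      have := hg n
      exact Continuous.continuousAt (by fun_prop)
  have h_inj : Function.Injective h := by
    intro z w hzw
    rcases hcases z with hz | ⟨n, hlt, hn⟩ <;> rcases hcases w with hw | ⟨m, hlt', hm⟩
    · funext k
      rw [hz, hw]
    · rw [h_x z hz, h_g w m hlt' hm] at hzw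
      exact absurd ⟨_, hzw.symm⟩ (hx m)
    · rw [h_x w hw, h_g z n hlt hn] at hzw
      exact absurd ⟨_, hzw⟩ (hx n)
    · rw [h_g z n hlt hn, h_g w m hlt' hm] at hzw
      have hnm : n = m := by
        by_contra hne
        exact Set.disjoint_left.1 (hd hne) ⟨_, rfl⟩ ⟨_, hzw.symm⟩
      subst hnm
      have := hinj n hzw
      funext k
      rcases lt_trichotomy k n with hk | rfl | hk
      · rw [hlt k hk, hlt' k hk]
      · rw [hn, hm]
      · have := congrFun this (k - (n + 1))
        simpa [Nat.add_sub_of_le (Nat.succ_le_of_lt hk)] using this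
  have hrange : range h = insert x (⋃ n, range (g n)) := by
    apply Subset.antisymm
    · rintro _ ⟨z, rfl⟩
      rcases hcases z with hz | ⟨n, hlt, hn⟩
      · rw [h_x z hz]
        exact mem_insert _ _
      · rw [h_g z n hlt hn]
        exact Or.inr (mem_iUnion.2 ⟨n, _, rfl⟩)
    · rintro y (rfl | hy)
      · exact ⟨fun _ => true, h_x _ fun _ => rfl⟩
      · obtain ⟨n, y, rfl⟩ := mem_iUnion.1 hy
        refine ⟨fun k => if k < n then true else if k = n then false else y (k - (n + 1)), ?_⟩
        rw [h_g _ n (fun k hk => by simp [hk]) (by simp)]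
        congr 1
        funext k
        have h1 : ¬ (n + 1 + k < n) := by omega
        have h2 : n + 1 + k ≠ n := by omega
        simp [h1, h2]
  exact hrange ▸ isCantorSet_range hcont h_inj

/-- A disjoint family of Cantor sets absorbs the points that it does not cover, if sufficiently
many members of the family are close to each of these points. -/
theorem hasCantorPartition_univ_of_mk_mul_aleph0_le {X J : Type u} [MetricSpace X]
    {G : J → CantorSpace → X} (hG : ∀ j, Continuous (G j))
    (hinj : Function.Injective (Function.uncurry G))
    (hcard : ∀ x ∉ ⋃ j, range (G j), ∀ ε > 0, #((⋃ j, range (G j))ᶜ : Set X) * ℵ₀ ≤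
      #{j | (range (G j) ∩ Metric.ball x ε).Nonempty}) :
    HasCantorPartition (univ : Set X) := by
  set C : Set X := (⋃ j, range (G j))ᶜ with hC
  have hGC : ∀ x : C, ∀ j z, G j z ≠ x := fun x j z h => x.2 (mem_iUnion.2 ⟨j, z, h⟩)
  have hinj₁ : ∀ j, Function.Injective (G j) := fun j y z h =>
    (Prod.mk.inj (hinj (a₁ := (j, y)) (a₂ := (j, z)) h)).2
  have hinj₂ : ∀ {i j y z}, G i y = G j z → i = j := fun {i j y z} h =>
    (Prod.mk.inj (hinj (a₁ := (i, y)) (a₂ := (j, z)) h)).1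
  obtain ⟨φ, hφ, hφS⟩ := exists_injective_choice (ι := C × ℕ)
    (S := fun p => {j | (range (G j) ∩ Metric.ball (p.1 : X) (1 / ((p.2 : ℝ) + 1))).Nonempty})
    (fun p => by simpa using hcard p.1 p.1.2 _ (by positivity))
  have hcyl : ∀ p : C × ℕ, ∃ b m, ∀ z, z ∈ range (cantorGlue b m) →
      G (φ p) z ∈ Metric.ball (p.1 : X) (1 / ((p.2 : ℝ) + 1)) := by
    intro p
    obtain ⟨_, ⟨b, rfl⟩, hb⟩ := hφS p
    obtain ⟨m, hm⟩ := exists_range_cantorGlue_subset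
      (Metric.isOpen_ball.preimage (hG (φ p))) hb
    exact ⟨b, m, fun z hz => hm hz⟩
  choose b m hbm using hcyl
  let T : C → Set X := fun x =>
    insert (x : X) (⋃ n, range (G (φ (x, n)) ∘ cantorGlue (b (x, n)) (m (x, n))))
  let M : J → Set CantorSpace := fun j => {z | ∃ p, φ p = j ∧ z ∈ range (cantorGlue (b p) (m p))}
  have hT : ∀ x, HasCantorPartition (T x) := by
    intro x
    refine (isCantorSet_insert_iUnion (fun n => (hG _).comp (continuous_cantorGlue _ _))
      (fun n => (hinj₁ _).comp (injective_cantorGlue _ _)) ?_ ?_ ?_).hasCantorPartition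
    · intro k n hkn
      rw [Set.disjoint_left]
      rintro _ ⟨y, rfl⟩ ⟨z, hz⟩
      have := hφ (hinj₂ hz)
      exact hkn (Prod.mk.inj this).2.symm
    · rintro n ⟨z, hz⟩
      exact hGC x _ _ hz
    · rintro n _ ⟨z, rfl⟩
      exact hbm (x, n) _ ⟨z, rfl⟩
  have hR : ∀ j, HasCantorPartition (G j '' (M j)ᶜ) := by
    intro j
    refine HasCantorPartition.image ?_ (hG j) (hinj₁ j)
    by_cases hj : ∃ p, φ p = j
    · obtain ⟨p, rfl⟩ := hj
      have : M (φ p) = range (cantorGlue (b p) (m p)) := by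
        ext z
        exact ⟨fun ⟨q, hq, hz⟩ => hφ hq ▸ hz, fun hz => ⟨p, rfl, hz⟩⟩
      rw [this]
      exact hasCantorPartition_compl_range_cantorGlue _ _
    · have : (M j)ᶜ = Set.univ := by
        rw [compl_univ_iff, eq_empty_iff_forall_notMem]
        rintro z ⟨p, hp, -⟩
        exact hj ⟨p, hp⟩
      rw [this, ← range_id]
      exact (isCantorSet_range continuous_id Function.injective_id).hasCantorPartition
  have hTmem : ∀ x y, y ∈ T x → y = x ∨ ∃ n z, z ∈ M (φ (x, n)) ∧ y = G (φ (x, n)) z := by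
    rintro x y (rfl | hy)
    · exact Or.inl rfl
    · obtain ⟨n, z, rfl⟩ := mem_iUnion.1 hy
      exact Or.inr ⟨n, _, ⟨_, rfl, z, rfl⟩, rfl⟩
  have hTd : Pairwise fun x y => Disjoint (T x) (T y) := by
    intro x y hxy
    rw [Set.disjoint_left]
    intro p hpx hpy
    rcases hTmem x p hpx with h1 | ⟨n, z, -, h1⟩ <;> rcases hTmem y p hpy with h2 | ⟨k, w, -, h2⟩
    · exact hxy (Subtype.ext (h1.symm.trans h2))
    · exact hGC x _ _ (h2.symm.trans h1)
    · exact hGC y _ _ (h1.symm.trans h2)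
    · exact hxy (Prod.mk.inj (hφ (hinj₂ (h1.symm.trans h2)))).1
  have hRd : Pairwise fun i j => Disjoint (G i '' (M i)ᶜ) (G j '' (M j)ᶜ) := by
    intro i j hij
    rw [Set.disjoint_left]
    rintro _ ⟨y, -, rfl⟩ ⟨z, -, hz⟩
    exact hij (hinj₂ hz).symm
  have hTR : Disjoint (⋃ x, T x) (⋃ j, G j '' (M j)ᶜ) := by
    simp only [disjoint_iUnion_left, disjoint_iUnion_right]
    intro j x
    rw [Set.disjoint_left]
    rintro p hp ⟨z, hz, rfl⟩
    rcases hTmem x _ hp with h | ⟨n, w, hw, h⟩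
    · exact hGC x _ _ h
    · obtain rfl := hinj₂ h
      exact hz (hinj₁ _ h ▸ hw)
  have huniv : (univ : Set X) = (⋃ x, T x) ∪ ⋃ j, G j '' (M j)ᶜ := by
    refine (eq_univ_of_forall fun y => ?_).symm
    by_cases hy : y ∈ C
    · exact Or.inl (mem_iUnion.2 ⟨⟨y, hy⟩, mem_insert _ _⟩)
    · obtain ⟨j, z, rfl⟩ := mem_iUnion.1 (not_not.1 hy)
      by_cases hz : z ∈ M j
      · obtain ⟨⟨x, n⟩, rfl, w, rfl⟩ := hz
        exact Or.inl (mem_iUnion.2 ⟨x, Or.inr (mem_iUnion.2 ⟨n, w, rfl⟩)⟩)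
      · exact Or.inr (mem_iUnion.2 ⟨j, z, hz, rfl⟩)
  rw [huniv]
  exact (HasCantorPartition.iUnion hT hTd).union (HasCantorPartition.iUnion hR hRd) hTR

end Absorption

section Splitting

universe u

theorem nonempty_homeomorph_cantorSpace_prod :
    Nonempty (CantorSpace × CantorSpace ≃ₜ CantorSpace) :=
  ⟨(Homeomorph.sumArrowHomeomorphProdArrow (X := Bool) (ι := ℕ) (ι' := ℕ)).symm.trans
    (Homeomorph.piCongrLeft (Y := fun _ => Bool) Equiv.natSumNatEquivNat)⟩

variable {X : Type u}

theorem mk_inter_iUnion_range_le {J : Type u} {G : J → CantorSpace → X} {B : Set X} :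
    #(B ∩ ⋃ j, range (G j) : Set X) ≤ max #{j | (range (G j) ∩ B).Nonempty} 𝔠 := by
  set S := {j | (range (G j) ∩ B).Nonempty}
  have hsub : B ∩ ⋃ j, range (G j) ⊆ range fun p : S × CantorSpace => G p.1 p.2 := by
    rintro x ⟨hxB, hx⟩
    obtain ⟨j, z, rfl⟩ := mem_iUnion.1 hx
    exact ⟨(⟨j, _, ⟨z, rfl⟩, hxB⟩, z), rfl⟩
  calc #(B ∩ ⋃ j, range (G j) : Set X) ≤ #(range fun p : S × CantorSpace => G p.1 p.2) :=
        mk_le_mk_of_subset hsub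
    _ ≤ #(S × CantorSpace) := mk_range_le
    _ = #S * 𝔠 := by simp
    _ ≤ max #S 𝔠 := by
      refine mul_le_of_le (aleph0_le_continuum.trans (le_max_right _ _)) (le_max_left _ _)
        (le_max_right _ _)

/-- A maximal disjoint family of Cantor sets can be modified to a partition if the points that it
does not cover only have neighborhoods of full cardinality. -/
theorem hasCantorPartition_univ_of_maximal_packing [MetricSpace X] [CompleteSpace X]
    [PerfectSpace X] {Q : Set (Set X)} (hQ : IsPacking CantorSpace Q)
    (hmax : ∀ K, IsCantorSet K → (K ∩ ⋃₀ Q).Nonempty)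
    (hcard : ∀ x ∉ ⋃₀ Q, ∀ ε > 0, #X ≤ #(Metric.ball x ε)) :
    HasCantorPartition (univ : Set X) := by
  obtain ⟨e⟩ := nonempty_homeomorph_cantorSpace_prod
  choose f hf hfi hfr using fun K : Q => IsCantorSet.exists_param (hQ.1 K K.2)
  let G : Q × CantorSpace → CantorSpace → X := fun j z => f j.1 (e (j.2, z))
  have hG : ∀ j, Continuous (G j) := fun j => (hf j.1).comp (by fun_prop)
  have hGinj : Function.Injective (Function.uncurry G) := by
    rintro ⟨⟨K, a⟩, y⟩ ⟨⟨L, b⟩, z⟩ h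
    have h' : f K (e (a, y)) = f L (e (b, z)) := h
    have hKL : K = L := by
      by_contra hne
      have hd : Disjoint (K : Set X) L := hQ.2 K.2 L.2 (Subtype.coe_ne_coe.2 hne)
      rw [← hfr K, ← hfr L, Set.disjoint_left] at hd
      exact hd (mem_range_self _) ⟨_, h'.symm⟩
    subst hKL
    have := e.injective (hfi K h')
    simp only [Prod.mk.injEq] at this
    simp [this]
  have hrange : ⋃ j, range (G j) = ⋃₀ Q := by
    ext x
    simp only [mem_iUnion, mem_sUnion]
    constructor
    · rintro ⟨⟨K, a⟩, z, rfl⟩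
      exact ⟨K, K.2, (hfr K) ▸ mem_range_self _⟩
    · rintro ⟨K, hK, hx⟩
      obtain ⟨w, rfl⟩ := (hfr ⟨K, hK⟩).ge hx
      obtain ⟨⟨a, z⟩, rfl⟩ := e.surjective w
      exact ⟨(⟨K, hK⟩, a), z, rfl⟩
  refine hasCantorPartition_univ_of_mk_mul_aleph0_le hG hGinj ?_
  rw [hrange]
  intro x hx ε hε
  set B := Metric.ball x ε with hB
  set S := {j | (range (G j) ∩ B).Nonempty} with hS
  have hcS : 𝔠 ≤ #S := by
    obtain ⟨K, hKB, hK⟩ := exists_isCantorSet_subset (X := X) (O := B) Metric.isOpen_ball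
      ⟨x, Metric.mem_ball_self hε⟩
    obtain ⟨y, hyK, hyQ⟩ := hmax K hK
    rw [← hrange] at hyQ
    obtain ⟨⟨L, a⟩, b, rfl⟩ := mem_iUnion.1 hyQ
    let V : Set CantorSpace := {c | f L (e (c, b)) ∈ B}
    have hV : IsOpen V := Metric.isOpen_ball.preimage ((hf L).comp (by fun_prop))
    have h1 := continuum_le_mk_of_isOpen_cantorSpace hV ⟨a, hKB hyK⟩
    have h2 : lift.{u} #V ≤ lift.{0} #S :=
      lift_mk_le_lift_mk_of_injective (f := fun c : V => (⟨(L, c), _, ⟨b, rfl⟩, c.2⟩ : S))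
        fun c d hcd => by simpa [Subtype.ext_iff] using hcd
    simpa using (lift_le.{u}.2 h1).trans h2
  have hXS : #X ≤ #S := by
    calc #X ≤ #B := hcard x hx ε hε
      _ ≤ max #(B ∩ ⋃₀ Q : Set X) 𝔠 := mk_le_max_mk_inter_continuum hmax Metric.isOpen_ball
      _ ≤ #S := by
        rw [← hrange]
        exact max_le (mk_inter_iUnion_range_le.trans (max_le le_rfl hcS)) hcS
  exact mul_le_of_le (aleph0_le_continuum.trans hcS) ((mk_set_le _).trans hXS)
    (aleph0_le_continuum.trans hcS)

end Splitting

section Decomposition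

universe u

theorem pairwise_disjoint_of_lt {α ι : Type*} [LinearOrder ι] {S : ι → Set α}
    (h : ∀ i j, i < j → Disjoint (S i) (S j)) : Pairwise fun i j => Disjoint (S i) (S j) := by
  intro i j hij
  rcases lt_or_gt_of_ne hij with hlt | hlt
  · exact h i j hlt
  · exact (h j i hlt).symm

variable {Y : Type u} [TopologicalSpace Y]

theorem isCompletelyMetrizableSpace_of_isOpen [IsCompletelyMetrizableSpace Y] {O : Set Y}
    (hO : IsOpen O) : IsCompletelyMetrizableSpace O := by
  let _ := upgradeIsCompletelyMetrizable Y
  exact inferInstanceAs (IsCompletelyMetrizableSpace (Opens.CompleteCopy (⟨O, hO⟩ : Opens Y)))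

theorem isCompletelyMetrizableSpace_inter [IsCompletelyMetrizableSpace Y] {F O : Set Y}
    (hF : IsClosed F) (hO : IsOpen O) : IsCompletelyMetrizableSpace (F ∩ O : Set Y) := by
  have _ := isCompletelyMetrizableSpace_of_isOpen hO
  refine Topology.IsClosedEmbedding.IsCompletelyMetrizableSpace
    (f := Set.inclusion (inter_subset_right : F ∩ O ⊆ O)) ⟨Topology.IsEmbedding.inclusion _, ?_⟩
  rw [range_inclusion]
  convert hF.preimage (continuous_subtype_val (p := (· ∈ O))) using 1
  ext x
  simp only [mem_inter_iff, mem_ofPred_eq, mem_preimage]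
  exact and_iff_left x.2

theorem perfectSpace_of_subset_closure [PerfectSpace Y] {V S : Set Y} (hV : IsOpen V)
    (hVS : V ⊆ S) (hSV : S ⊆ closure V) : PerfectSpace S := by
  refine perfectSpace_of_not_isOpen_singleton fun x hx => ?_
  obtain ⟨O, hO, hOx⟩ := isOpen_induced_iff.1 hx
  have hxO : (x : Y) ∈ O := by
    have : x ∈ Subtype.val ⁻¹' O := hOx ▸ mem_singleton x
    exact this
  have huniq : ∀ y ∈ O ∩ V, y = x := by
    rintro y ⟨hyO, hyV⟩
    have : (⟨y, hVS hyV⟩ : S) ∈ Subtype.val ⁻¹' O := hyO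
    rw [hOx] at this
    exact congrArg Subtype.val (mem_singleton_iff.1 this)
  have hne := mem_closure_iff.1 (hSV x.2) O hO hxO
  refine not_isOpen_singleton_of_perfectSpace (x : Y) ?_
  have : O ∩ V = {(x : Y)} := (eq_singleton_iff_nonempty_unique_mem).2 ⟨hne, huniq⟩
  exact this ▸ hO.inter hV

theorem HasCantorPartition.of_univ_subtype [T2Space Y] {S : Set Y}
    (h : HasCantorPartition (Set.univ : Set S)) : HasCantorPartition S := by
  simpa using h.image continuous_subtype_val Subtype.val_injective

theorem LocallyFinite.isOpen_compl_iUnion_closure {ι : Type*} [LinearOrder ι]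
    {W : ι → Set Y} (hW : LocallyFinite W) (i : ι) : IsOpen (⋃ j : Iio i, closure (W j))ᶜ :=
  ((hW.closure.comp_injective Subtype.val_injective).isClosed_iUnion
    fun _ => isClosed_closure).isOpen_compl

/-- A locally finite open cover is refined by a disjoint family of open sets with dense union. -/
theorem exists_disjoint_isOpen_refinement {ι : Type*} [LinearOrder ι] [WellFoundedLT ι]
    {W : ι → Set Y} (hW : ∀ i, IsOpen (W i)) (hWU : ⋃ i, W i = Set.univ) (hWlf : LocallyFinite W) :
    ∃ V : ι → Set Y, (∀ i, IsOpen (V i)) ∧ (∀ i, V i ⊆ W i) ∧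
      (Pairwise fun i j => Disjoint (V i) (V j)) ∧ ⋃ i, closure (V i) = Set.univ := by
  let V : ι → Set Y := fun i => W i ∩ (⋃ j : Iio i, closure (W j))ᶜ
  have hVlf : LocallyFinite V := hWlf.subset fun i => inter_subset_left
  have hVdense : Dense (⋃ i, V i) := by
    rw [dense_iff_inter_open]
    rintro O hO ⟨y, hy⟩
    have hne : {i | (O ∩ W i).Nonempty}.Nonempty := by
      obtain ⟨i, hi⟩ := mem_iUnion.1 (hWU ▸ mem_univ y)
      exact ⟨i, y, hy, hi⟩
    obtain ⟨i, ⟨x, hxO, hxW⟩, hmin⟩ := wellFounded_lt.has_min _ hne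
    refine ⟨x, hxO, mem_iUnion.2 ⟨i, hxW, fun hx => ?_⟩⟩
    obtain ⟨j, hj⟩ := mem_iUnion.1 hx
    exact hmin j (mem_closure_iff.1 hj O hO hxO) j.2
  refine ⟨V, fun i => (hW i).inter (hWlf.isOpen_compl_iUnion_closure i),
    fun i => inter_subset_left, ?_, ?_⟩
  · refine pairwise_disjoint_of_lt fun i j hij => Set.disjoint_left.2 fun x hi hj => hj.2 ?_
    exact mem_iUnion.2 ⟨⟨i, hij⟩, subset_closure hi.1⟩
  · refine eq_univ_of_univ_subset ?_
    rw [← hVdense.closure_eq]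
    exact closure_minimal (iUnion_mono fun i => subset_closure)
      (hVlf.closure.isClosed_iUnion fun _ => isClosed_closure)

/-- The closures of a locally finite disjoint family of open sets can be made disjoint by removing
boundary points. -/
theorem exists_disjoint_inter_isOpen {ι : Type*} [LinearOrder ι] [WellFoundedLT ι]
    {V : ι → Set Y} (hV : ∀ i, IsOpen (V i)) (hVd : Pairwise fun i j => Disjoint (V i) (V j))
    (hVU : ⋃ i, closure (V i) = Set.univ) (hVlf : LocallyFinite V) :
    ∃ O : ι → Set Y, (∀ i, IsOpen (O i)) ∧ (∀ i, V i ⊆ O i) ∧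
      (Pairwise fun i j => Disjoint (closure (V i) ∩ O i) (closure (V j) ∩ O j)) ∧
      ⋃ i, closure (V i) ∩ O i = Set.univ := by
  refine ⟨fun i => (⋃ j : Iio i, closure (V j))ᶜ, hVlf.isOpen_compl_iUnion_closure, ?_, ?_, ?_⟩
  · intro i x hx hx'
    obtain ⟨j, hj⟩ := mem_iUnion.1 hx'
    obtain ⟨y, hyi, hyj⟩ := mem_closure_iff.1 hj _ (hV i) hx
    exact Set.disjoint_left.1 (hVd (ne_of_lt (mem_Iio.1 j.2))) hyj hyi
  · refine pairwise_disjoint_of_lt fun i j hij => Set.disjoint_left.2 fun x hi hj => hj.2 ?_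
    exact mem_iUnion.2 ⟨⟨i, hij⟩, hi.1⟩
  · refine eq_univ_of_forall fun y => ?_
    have hne : {i | y ∈ closure (V i)}.Nonempty := mem_iUnion.1 (hVU ▸ mem_univ y)
    obtain ⟨i, hi, hmin⟩ := wellFounded_lt.has_min _ hne
    refine mem_iUnion.2 ⟨i, hi, fun hy => ?_⟩
    obtain ⟨j, hj⟩ := mem_iUnion.1 hy
    exact hmin j hj j.2

/-- A space which is locally of cardinality less than `μ` has a partition into Cantor sets if all
spaces of cardinality less than `μ` do. -/
theorem hasCantorPartition_univ_of_locally_lt [IsCompletelyMetrizableSpace Y] [PerfectSpace Y]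
    {μ : Cardinal.{u}} (hloc : ∀ y : Y, ∃ W ∈ nhds y, #W < μ)
    (ih : ∀ (Z : Type u) [TopologicalSpace Z] [IsCompletelyMetrizableSpace Z] [PerfectSpace Z],
      #Z < μ → HasCantorPartition (Set.univ : Set Z)) :
    HasCantorPartition (Set.univ : Set Y) := by
  have _ : ParacompactSpace Y := by
    let _ := upgradeIsCompletelyMetrizable Y
    infer_instance
  have hloc' : ∀ y : Y, ∃ N : Set Y, IsOpen N ∧ y ∈ N ∧ #(closure N) < μ := by
    intro y
    obtain ⟨W, hW, hlt⟩ := hloc y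
    obtain ⟨F, ⟨hF, hFc⟩, hFW⟩ := (closed_nhds_basis y).mem_iff.1 hW
    exact ⟨interior F, isOpen_interior, mem_interior_iff_mem_nhds.2 hF,
      (mk_le_mk_of_subset ((closure_minimal interior_subset hFc).trans hFW)).trans_lt hlt⟩
  choose N hN hyN hNμ using hloc'
  obtain ⟨W, hW, hWU, hWlf, hWN⟩ := precise_refinement N hN
    (eq_univ_of_forall fun y => mem_iUnion.2 ⟨y, hyN y⟩)
  obtain ⟨_, _⟩ := exists_wellFoundedLT Y
  obtain ⟨V, hV, hVW, hVd, hVU⟩ := exists_disjoint_isOpen_refinement hW hWU hWlf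
  obtain ⟨O, hO, hVO, hd, hU⟩ := exists_disjoint_inter_isOpen hV hVd hVU (hWlf.subset hVW)
  rw [← hU]
  refine HasCantorPartition.iUnion (fun i => ?_) hd
  have _ := isCompletelyMetrizableSpace_inter (isClosed_closure (s := V i)) (hO i)
  have _ : PerfectSpace (closure (V i) ∩ O i : Set Y) :=
    perfectSpace_of_subset_closure (hV i) (subset_inter subset_closure (hVO i)) inter_subset_left
  refine (ih (closure (V i) ∩ O i : Set Y) ?_).of_univ_subtype
  exact (mk_le_mk_of_subset (inter_subset_left.trans
    (closure_mono ((hVW i).trans (hWN i))))).trans_lt (hNμ i)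

/-- A completely metrizable space without isolated points has a partition into Cantor sets. -/
theorem hasCantorPartition_univ (X : Type u) [TopologicalSpace X] [IsCompletelyMetrizableSpace X]
    [PerfectSpace X] : HasCantorPartition (Set.univ : Set X) := by
  suffices ∀ (μ : Cardinal.{u}) (X : Type u) [TopologicalSpace X] [IsCompletelyMetrizableSpace X]
      [PerfectSpace X], #X = μ → HasCantorPartition (Set.univ : Set X) from this _ X rfl
  intro μ
  induction μ using WellFoundedLT.induction with | _ μ ih
  intro X _ _ _ hX
  let U : Set X := {x | ∃ W ∈ nhds x, #W < μ}
  have hU : IsOpen U := by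
    rw [isOpen_iff_mem_nhds]
    rintro x ⟨W, hW, hlt⟩
    filter_upwards [eventually_mem_nhds_iff.2 hW] with y hy
    exact ⟨W, hy, hlt⟩
  have _ := isCompletelyMetrizableSpace_of_isOpen hU
  have _ : PerfectSpace U := perfectSpace_of_subset_closure hU le_rfl subset_closure
  have hUP : HasCantorPartition U := by
    refine (hasCantorPartition_univ_of_locally_lt (μ := μ) ?_
      fun Z _ _ _ hZ => ih _ hZ Z rfl).of_univ_subtype
    rintro ⟨x, W, hW, hlt⟩
    refine ⟨Subtype.val ⁻¹' W, continuous_subtype_val.continuousAt.preimage_mem_nhds hW, ?_⟩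
    exact (mk_preimage_of_injective _ _ Subtype.val_injective).trans_lt hlt
  obtain ⟨P, hP, hPd, hPU⟩ := hUP
  obtain ⟨Q, hPQ, hQ, hmax⟩ := exists_maximal_packing ⟨hP, hPd⟩
  let _ := upgradeIsCompletelyMetrizable X
  refine hasCantorPartition_univ_of_maximal_packing hQ hmax fun x hx ε hε => ?_
  by_contra! hlt
  refine hx (sUnion_subset_sUnion hPQ ?_)
  rw [hPU]
  exact ⟨_, Metric.ball_mem_nhds x hε, hX ▸ hlt⟩

end Decomposition

theorem stmt_15 {X : Type*} [TopologicalSpace X] (hX : CompletelyMetrizable X) :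
    (Partitionable X CantorSpace ↔ Coverable X CantorSpace) ∧
    (Coverable X CantorSpace ↔ ∀ x : X, ¬ IsOpen ({x} : Set X)) := by
  have _ : IsCompletelyMetrizableSpace X := ⟨hX⟩
  have key : (∀ x : X, ¬ IsOpen ({x} : Set X)) → Partitionable X CantorSpace := by
    intro h
    have _ := perfectSpace_of_not_isOpen_singleton h
    exact hasCantorPartition_univ X
  exact ⟨⟨Partitionable.coverable, fun h => key h.not_isOpen_singleton⟩,
    fun h => h.not_isOpen_singleton, fun h => (key h).coverable⟩
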